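/- Second-order expansion of the two-balanced-groups state-evolution function at the uniform fixed point: for every ρ ∈ (0,1), lim_{y→0⁺} ( f_ρ(y) − y ) / y² = ( 1 − 6ρ(1−ρ) ) / ( 2ρ(1−ρ) ). Equivalently, f_ρ(y) = y + y²·(1 − 6ρ(1−ρ))/(2ρ(1−ρ)) + o(y²) as y → 0⁺; in particular the quadratic coefficient is positive if and only if ρ(1−ρ) < 1/6. -/

import Mathlib

open MeasureTheory ProbabilityTheory Filter

/-- The two-balanced-groups state-evolution function
`f_ρ(x) = E_W[ 2ρ(1−ρ)·sinh( x/(2ρ(1−ρ)) + W·√(x/(ρ(1−ρ))) )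
              / ( 1 + 2ρ(1−ρ)·( cosh( x/(2ρ(1−ρ)) + W·√(x/(ρ(1−ρ))) ) − 1 ) ) ]`. -/
noncomputable def fBal (ρ x : ℝ) : ℝ :=
  ∫ w, 2 * ρ * (1 - ρ) *
      Real.sinh (x / (2 * ρ * (1 - ρ)) + w * Real.sqrt (x / (ρ * (1 - ρ)))) /
      (1 + 2 * ρ * (1 - ρ) *
        (Real.cosh (x / (2 * ρ * (1 - ρ)) + w * Real.sqrt (x / (ρ * (1 - ρ)))) - 1))
    ∂(gaussianReal 0 1)

lemma Real.abs_exp_sub_sum_le_abs_pow_mul_exp (x : ℝ) (n : ℕ) :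
    |Real.exp x - ∑ m ∈ Finset.range n, x ^ m / m.factorial| ≤ |x| ^ n * Real.exp |x| := by
  have h := Complex.norm_exp_sub_sum_le_norm_mul_exp (x : ℂ) n
  rw [Complex.norm_real, Real.norm_eq_abs] at h
  refine le_of_eq_of_le ?_ h
  rw [← Real.norm_eq_abs, ← Complex.norm_real]
  push_cast
  rfl

lemma Real.exp_abs_le_two_mul_cosh (x : ℝ) : Real.exp |x| ≤ 2 * Real.cosh x := by
  rw [← Real.cosh_abs, Real.cosh_eq]
  linarith [Real.exp_pos (-|x|)]

lemma Real.abs_sinh_sub_cubic_le (x : ℝ) :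
    |Real.sinh x - (x + x ^ 3 / 6)| ≤ 2 * |x| ^ 5 * Real.cosh x := by
  have h₁ := Real.abs_exp_sub_sum_le_abs_pow_mul_exp x 5
  have h₂ := Real.abs_exp_sub_sum_le_abs_pow_mul_exp (-x) 5
  have h₃ := mul_le_mul_of_nonneg_left (Real.exp_abs_le_two_mul_cosh x)
    (pow_nonneg (abs_nonneg x) 5)
  simp only [Finset.sum_range_succ, Finset.sum_range_zero, Nat.factorial, abs_neg] at h₁ h₂
  norm_num at h₁ h₂
  rw [abs_le] at *
  rw [Real.sinh_eq]
  constructor <;> nlinarith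

lemma Real.abs_cosh_sub_quadratic_le (x : ℝ) :
    |Real.cosh x - (1 + x ^ 2 / 2)| ≤ 2 * |x| ^ 4 * Real.cosh x := by
  have h₁ := Real.abs_exp_sub_sum_le_abs_pow_mul_exp x 4
  have h₂ := Real.abs_exp_sub_sum_le_abs_pow_mul_exp (-x) 4
  have h₃ := mul_le_mul_of_nonneg_left (Real.exp_abs_le_two_mul_cosh x)
    (pow_nonneg (abs_nonneg x) 4)
  simp only [Finset.sum_range_succ, Finset.sum_range_zero, Nat.factorial, abs_neg] at h₁ h₂
  norm_num at h₁ h₂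
  rw [abs_le] at *
  have h₄ := Real.cosh_eq x
  constructor <;> nlinarith

/-- Global cubic Taylor bound for the integrand of `fBal`, with `b = 2ρ(1-ρ)`. -/
lemma abs_sinh_div_cosh_sub_cubic_le {b : ℝ} (hb : 0 < b) (hb' : b ≤ 1 / 2) (u : ℝ) :
    |b * Real.sinh u / (1 + b * (Real.cosh u - 1)) - b * (u + (1 - 3 * b) / 6 * u ^ 3)| ≤
      5 * (|u| ^ 5 + |u| ^ 7) := by
  obtain ⟨c, hc⟩ : ∃ c, c = (1 - 3 * b) / 6 := ⟨_, rfl⟩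
  rw [← hc]
  have hc_abs : |c| ≤ 1 := by rw [abs_le]; constructor <;> linarith
  have hC : 1 ≤ Real.cosh u := Real.one_le_cosh u
  have hbC : b * Real.cosh u ≤ 1 + b * (Real.cosh u - 1) := by linarith
  have hD : 0 < 1 + b * (Real.cosh u - 1) := by nlinarith
  obtain ⟨r, hr⟩ : ∃ r, r = Real.sinh u - (u + u ^ 3 / 6) := ⟨_, rfl⟩
  obtain ⟨q, hq⟩ : ∃ q, q = Real.cosh u - (1 + u ^ 2 / 2) := ⟨_, rfl⟩
  have hr_le : |r| ≤ 2 * |u| ^ 5 * Real.cosh u := hr ▸ Real.abs_sinh_sub_cubic_le u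
  have hq_le : |q| ≤ 2 * |u| ^ 4 * Real.cosh u := hq ▸ Real.abs_cosh_sub_quadratic_le u
  have hN : b * Real.sinh u / (1 + b * (Real.cosh u - 1)) - b * (u + c * u ^ 3) =
      b * (r - b * c / 2 * u ^ 5 - b * (u + c * u ^ 3) * q) /
        (1 + b * (Real.cosh u - 1)) := by
    rw [eq_div_iff hD.ne', sub_mul, div_mul_cancel₀ _ hD.ne', hr, hq, hc]
    ring
  rw [hN, abs_div, abs_of_pos hD, div_le_iff₀ hD, abs_mul, abs_of_pos hb]
  have hbc : |b * c / 2 * u ^ 5| ≤ |u| ^ 5 * Real.cosh u := by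
    rw [abs_mul, abs_pow, mul_comm]
    refine mul_le_mul_of_nonneg_left (le_trans ?_ hC) (by positivity)
    rw [abs_div, abs_mul, abs_of_pos hb, abs_two]
    nlinarith [abs_nonneg c]
  have hlin : |b * (u + c * u ^ 3)| ≤ |u| + |u| ^ 3 := by
    rw [abs_mul, abs_of_pos hb]
    have h₁ : |u + c * u ^ 3| ≤ |u| + |u| ^ 3 := by
      refine (abs_add_le _ _).trans (add_le_add le_rfl ?_)
      rw [abs_mul, abs_pow]
      exact mul_le_of_le_one_left (by positivity) hc_abs
    calc b * |u + c * u ^ 3| ≤ 1 * |u + c * u ^ 3| := by gcongr; linarith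
      _ ≤ _ := by rwa [one_mul]
  have hprod : |b * (u + c * u ^ 3) * q| ≤ 2 * (|u| ^ 5 + |u| ^ 7) * Real.cosh u := by
    rw [abs_mul]
    calc _ ≤ (|u| + |u| ^ 3) * (2 * |u| ^ 4 * Real.cosh u) := by gcongr
      _ = _ := by ring
  have hsum : |r - b * c / 2 * u ^ 5 - b * (u + c * u ^ 3) * q| ≤
      5 * (|u| ^ 5 + |u| ^ 7) * Real.cosh u := by
    have h₁ := abs_sub (r - b * c / 2 * u ^ 5) (b * (u + c * u ^ 3) * q)
    have h₂ := abs_sub r (b * c / 2 * u ^ 5)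
    have h₃ : 0 ≤ |u| ^ 7 * Real.cosh u := by positivity
    linarith
  calc b * |r - b * c / 2 * u ^ 5 - b * (u + c * u ^ 3) * q|
      ≤ b * (5 * (|u| ^ 5 + |u| ^ 7) * Real.cosh u) := by gcongr
    _ = 5 * (|u| ^ 5 + |u| ^ 7) * (b * Real.cosh u) := by ring
    _ ≤ _ := by gcongr

lemma integrable_pow_gaussianReal (n : ℕ) :
    Integrable (fun w : ℝ => w ^ n) (gaussianReal 0 1) := by
  have h := (memLp_id_gaussianReal' (μ := 0) (v := 1) (n : ENNReal)
    (ENNReal.natCast_ne_top n)).integrable_norm_pow'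
  refine h.mono' (by fun_prop) (Eventually.of_forall fun w => ?_)
  simp

lemma integral_sq_gaussianReal : ∫ w, w ^ 2 ∂(gaussianReal 0 1) = 1 := by
  have h := variance_fun_id_gaussianReal (μ := 0) (v := 1)
  rw [variance_eq_integral (by fun_prop)] at h
  simpa [integral_id_gaussianReal] using h

lemma integral_cube_gaussianReal : ∫ w, w ^ 3 ∂(gaussianReal 0 1) = 0 := by
  have h : ∫ w, w ^ 3 ∂(gaussianReal 0 1) = ∫ w, (-w) ^ 3 ∂(gaussianReal 0 1) := by
    conv_lhs => rw [← neg_zero, ← gaussianReal_map_neg]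
    rw [integral_map (by fun_prop) (by fun_prop)]
  simp only [Odd.neg_pow (by decide : Odd 3), integral_neg] at h
  linarith

lemma integral_cubic_gaussianReal (p₀ p₁ p₂ p₃ : ℝ) :
    Integrable (fun w : ℝ => p₀ + p₁ * w + p₂ * w ^ 2 + p₃ * w ^ 3) (gaussianReal 0 1) ∧
      ∫ w, (p₀ + p₁ * w + p₂ * w ^ 2 + p₃ * w ^ 3) ∂(gaussianReal 0 1) = p₀ + p₂ := by
  have h₀ : Integrable (fun _ : ℝ => p₀) (gaussianReal 0 1) := integrable_const _
  have h₁ : Integrable (fun w : ℝ => p₁ * w) (gaussianReal 0 1) := by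
    simpa using (integrable_pow_gaussianReal 1).const_mul p₁
  have h₂ := (integrable_pow_gaussianReal 2).const_mul p₂
  have h₃ := (integrable_pow_gaussianReal 3).const_mul p₃
  refine ⟨((h₀.add h₁).add h₂).add h₃, ?_⟩
  rw [integral_add (by exact (h₀.add h₁).add h₂) h₃, integral_add (by exact h₀.add h₁) h₂,
    integral_add h₀ h₁, integral_const_mul, integral_const_mul, integral_const_mul,
    integral_id_gaussianReal, integral_sq_gaussianReal, integral_cube_gaussianReal]
  simp

lemma integrable_abs_add_one_pow_gaussianReal (n : ℕ) :
    Integrable (fun w : ℝ => (|w| + 1) ^ n) (gaussianReal 0 1) := by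
  have h : MemLp (fun w : ℝ => |w| + 1) n (gaussianReal 0 1) :=
    (memLp_id_gaussianReal' (n : ENNReal) (ENNReal.natCast_ne_top n)).abs.add (memLp_const 1)
  refine h.integrable_norm_pow'.congr (Eventually.of_forall fun w => ?_)
  simp only [Real.norm_eq_abs]
  rw [abs_of_nonneg (by positivity)]

/-- Quantitative expansion of `fBal` in terms of the standard deviation `s = √(y / (ρ(1-ρ)))`. -/
lemma abs_fBal_sub_le {ρ s : ℝ} (hρ : ρ ∈ Set.Ioo (0 : ℝ) 1) (hs : 0 ≤ s) (hs' : s ≤ 1) :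
    |fBal ρ (ρ * (1 - ρ) * s ^ 2) - (ρ * (1 - ρ) * s ^ 2 +
        2 * ρ * (1 - ρ) * ((1 - 6 * ρ * (1 - ρ)) / 6) * (3 / 2 * s ^ 4 + s ^ 6 / 8))| ≤
      10 * (∫ w, (|w| + 1) ^ 7 ∂(gaussianReal 0 1)) * s ^ 5 := by
  have ha : 0 < ρ * (1 - ρ) := mul_pos hρ.1 (by linarith [hρ.2])
  obtain ⟨b, hb_def⟩ : ∃ b, b = 2 * ρ * (1 - ρ) := ⟨_, rfl⟩
  have hb : 0 < b := by linarith
  have hb' : b ≤ 1 / 2 := by nlinarith [sq_nonneg (2 * ρ - 1)]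
  let u : ℝ → ℝ := fun w => s ^ 2 / 2 + w * s
  let g : ℝ → ℝ := fun w => b * Real.sinh (u w) / (1 + b * (Real.cosh (u w) - 1))
  let p : ℝ → ℝ := fun w => b * (u w + (1 - 3 * b) / 6 * u w ^ 3)
  have hf : fBal ρ (ρ * (1 - ρ) * s ^ 2) = ∫ w, g w ∂(gaussianReal 0 1) := by
    have h₁ : ρ * (1 - ρ) * s ^ 2 / b = s ^ 2 / 2 := by
      rw [div_eq_div_iff hb.ne' two_ne_zero, hb_def]; ring
    have h₂ : √(ρ * (1 - ρ) * s ^ 2 / (ρ * (1 - ρ))) = s := by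
      rw [mul_div_cancel_left₀ _ ha.ne', Real.sqrt_sq hs]
    simp only [fBal, ← hb_def, h₁, h₂, g, u]
  have hp_eq : p = fun w => b * (s ^ 2 / 2 + (1 - 3 * b) / 6 * (s ^ 6 / 8)) +
      b * (s + (1 - 3 * b) / 6 * (3 / 4 * s ^ 5)) * w +
      b * ((1 - 3 * b) / 6 * (3 / 2 * s ^ 4)) * w ^ 2 +
      b * ((1 - 3 * b) / 6 * s ^ 3) * w ^ 3 := by
    funext w
    simp only [p, u]
    ring
  obtain ⟨hp_int, hp⟩ := integral_cubic_gaussianReal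
    (b * (s ^ 2 / 2 + (1 - 3 * b) / 6 * (s ^ 6 / 8)))
    (b * (s + (1 - 3 * b) / 6 * (3 / 4 * s ^ 5)))
    (b * ((1 - 3 * b) / 6 * (3 / 2 * s ^ 4)))
    (b * ((1 - 3 * b) / 6 * s ^ 3))
  rw [← hp_eq] at hp_int
  have hbound (w : ℝ) : ‖g w - p w‖ ≤ 10 * s ^ 5 * (|w| + 1) ^ 7 := by
    have hm : 1 ≤ |w| + 1 := by linarith [abs_nonneg w]
    have hu : |u w| ≤ s * (|w| + 1) := by
      refine (abs_add_le _ _).trans ?_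
      rw [abs_mul, abs_of_nonneg hs, abs_of_nonneg (by positivity)]
      nlinarith
    calc ‖g w - p w‖ ≤ 5 * (|u w| ^ 5 + |u w| ^ 7) :=
          abs_sinh_div_cosh_sub_cubic_le hb hb' (u w)
      _ ≤ 5 * ((s * (|w| + 1)) ^ 5 + (s * (|w| + 1)) ^ 7) := by gcongr
      _ = 5 * (s ^ 5 * (|w| + 1) ^ 5 + s ^ 7 * (|w| + 1) ^ 7) := by ring
      _ ≤ 5 * (s ^ 5 * (|w| + 1) ^ 7 + s ^ 5 * (|w| + 1) ^ 7) := by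
          have h₁ : (|w| + 1) ^ 5 ≤ (|w| + 1) ^ 7 := pow_le_pow_right₀ hm (by norm_num)
          have h₂ : s ^ 7 ≤ s ^ 5 := pow_le_pow_of_le_one hs hs' (by norm_num)
          gcongr
      _ = _ := by ring
  have hdom := (integrable_abs_add_one_pow_gaussianReal 7).const_mul (10 * s ^ 5)
  have hmeas : Measurable fun w => g w - p w := by
    simp only [g, p, u]
    fun_prop
  have hd : Integrable (fun w => g w - p w) (gaussianReal 0 1) :=
    hdom.mono' hmeas.aestronglyMeasurable (Eventually.of_forall hbound)
  have hg : Integrable g (gaussianReal 0 1) := by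
    refine (hd.add hp_int).congr (Eventually.of_forall fun w => ?_)
    simp
  have hmain := norm_integral_le_of_norm_le hdom (Eventually.of_forall hbound)
  rw [integral_sub hg hp_int, ← hf, hp_eq, hp, integral_const_mul, Real.norm_eq_abs,
    hb_def] at hmain
  convert hmain using 1
  · congr 1
    ring
  · ring

/-- **Second-order expansion of the two-balanced-groups state-evolution function at
the uniform fixed point**: for every `ρ ∈ (0,1)`,
`f_ρ(y) = y + y²·(1 − 6ρ(1−ρ))/(2ρ(1−ρ)) + o(y²)` as `y → 0⁺`. -/
theorem two_balanced_groups_second_order_expansion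
    (ρ : ℝ) (hρ : ρ ∈ Set.Ioo (0 : ℝ) 1) :
    Tendsto (fun y => (fBal ρ y - y) / y ^ 2)
      (nhdsWithin 0 (Set.Ioi 0))
      (nhds ((1 - 6 * ρ * (1 - ρ)) / (2 * ρ * (1 - ρ)))) := by
  have ha : 0 < ρ * (1 - ρ) := mul_pos hρ.1 (by linarith [hρ.2])
  obtain ⟨a, ha_def⟩ : ∃ a, a = ρ * (1 - ρ) := ⟨_, rfl⟩
  rw [← ha_def] at ha
  obtain ⟨K, hK⟩ : ∃ K, K = ∫ w, (|w| + 1) ^ 7 ∂(gaussianReal 0 1) := ⟨_, rfl⟩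
  let s : ℝ → ℝ := fun y => √(y / a)
  have hs : Tendsto s (nhdsWithin 0 (Set.Ioi 0)) (nhds 0) := by
    have h : Continuous s := by fun_prop
    simpa [s] using (h.tendsto 0).mono_left nhdsWithin_le_nhds
  have hs_le : ∀ᶠ y in nhdsWithin 0 (Set.Ioi 0), s y ≤ 1 := hs.eventually_le_const one_pos
  have hcorr : Tendsto (fun y => (1 - 6 * a) / (2 * a) + (1 - 6 * a) / (24 * a) * s y ^ 2)
      (nhdsWithin 0 (Set.Ioi 0)) (nhds ((1 - 6 * a) / (2 * a))) := by
    simpa using ((hs.pow 2).const_mul ((1 - 6 * a) / (24 * a))).const_add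
      ((1 - 6 * a) / (2 * a))
  have hdiff : Tendsto (fun y => (fBal ρ y - y) / y ^ 2 -
      ((1 - 6 * a) / (2 * a) + (1 - 6 * a) / (24 * a) * s y ^ 2))
      (nhdsWithin 0 (Set.Ioi 0)) (nhds 0) := by
    refine squeeze_zero_norm' ?_ (by simpa using hs.const_mul (10 * K / a ^ 2))
    filter_upwards [hs_le, self_mem_nhdsWithin] with y hsy hy
    have hy_pos : 0 < y := hy
    have hs_pos : 0 < s y := Real.sqrt_pos.2 (div_pos hy_pos ha)
    have hy_eq : y = a * s y ^ 2 := by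
      rw [Real.sq_sqrt (div_pos hy_pos ha).le, mul_div_cancel₀ _ ha.ne']
    have hmain := abs_fBal_sub_le hρ hs_pos.le hsy
    simp only [mul_assoc, ← ha_def] at hmain
    rw [← hy_eq, ← hK] at hmain
    have heq : (fBal ρ y - y) / y ^ 2 -
        ((1 - 6 * a) / (2 * a) + (1 - 6 * a) / (24 * a) * s y ^ 2) =
        (fBal ρ y - (y + 2 * (a * ((1 - 6 * a) / 6 * (3 / 2 * s y ^ 4 + s y ^ 6 / 8))))) /
          y ^ 2 := by
      generalize s y = t at *
      generalize fBal ρ y = F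
      subst hy_eq
      field_simp
      ring
    rw [heq, norm_div, Real.norm_eq_abs, Real.norm_of_nonneg (by positivity),
      div_le_iff₀ (by positivity)]
    refine hmain.trans_eq ?_
    generalize s y = t at *
    subst hy_eq
    field_simp
  have hsum := hdiff.add hcorr
  simp only [sub_add_cancel, zero_add] at hsum
  convert hsum using 2
  rw [ha_def]
  ring
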